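/- Let η ∈ (0,1) and ε > 0, and assume a ≠ 0. If n ≥ max( 288·‖a‖²·σ²·d²·A_d²/(ε²·C_d²)·log(12d/η), 18·d²·A_d²/C_d²·log(24d²/η), 648·d⁵·A_d⁴·(3·f(μ̃)² + σ̃²·‖a‖²)/(C_d²·ε²)·log(24d²/η) ), then with probability at least 1 − η, the empirical covariance matrix Σ̂ is invertible and the weighted least-squares coefficient vector β̂ = Σ̂⁻¹·Γ̂ satisfies ‖β̂ − Σ⁻¹·Γ‖ ≤ ε, where ‖·‖ is the Euclidean norm on ℝ^{d+1}. -/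

import Mathlib

open Real MeasureTheory ProbabilityTheory Matrix

/-- A finite product measure with a product density is the product of the measures with density. -/
theorem pi_withDensity_prod {ι : Type*} [Fintype ι] {E : ι → Type*} [∀ i, MeasurableSpace (E i)]
    (Q : ∀ i, Measure (E i)) [∀ i, IsProbabilityMeasure (Q i)] (g : ∀ i, E i → ENNReal)
    (hg : ∀ i, Measurable (g i)) [∀ i, SigmaFinite ((Q i).withDensity (g i))] :
    (Measure.pi Q).withDensity (fun x => ∏ i, g i (x i)) =
      Measure.pi fun i => (Q i).withDensity (g i) := by
  symm
  refine Measure.pi_eq fun s hs => ?_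
  rw [withDensity_apply _ (MeasurableSet.univ_pi hs),
    ← lintegral_indicator (MeasurableSet.univ_pi hs)]
  have hind : iIndepFun (fun i (x : ∀ i, E i) => (s i).indicator (g i) (x i)) (Measure.pi Q) :=
    iIndepFun_pi (X := fun i => (s i).indicator (g i))
      fun i => ((hg i).indicator (hs i)).aemeasurable
  have hprod : ∀ x : ∀ i, E i, (Set.univ.pi s).indicator (fun x => ∏ i, g i (x i)) x =
      ∏ i, (s i).indicator (g i) (x i) := by
    intro x
    by_cases hx : x ∈ Set.univ.pi s
    · rw [Set.indicator_of_mem hx]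
      exact Finset.prod_congr rfl fun i _ => (Set.indicator_of_mem (hx i trivial) _).symm
    · rw [Set.indicator_of_notMem hx]
      simp only [Set.mem_pi, Set.mem_univ, true_implies, not_forall] at hx
      obtain ⟨i, hi⟩ := hx
      exact (Finset.prod_eq_zero (Finset.mem_univ i) (Set.indicator_of_notMem hi _)).symm
  simp_rw [hprod]
  rw [lintegral_prod_eq_prod_lintegral_of_indepFun _ _ hind
    fun i => ((hg i).indicator (hs i)).comp (measurable_pi_apply i)]
  refine Finset.prod_congr rfl fun i _ => ?_
  rw [withDensity_apply _ (hs i), ← lintegral_indicator (hs i),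
    ← (measurePreserving_eval Q i).map_eq, lintegral_map ((hg i).indicator (hs i))
      (measurable_pi_apply i)]

theorem pi_smul_eq_prod_smul_pi {ι : Type*} [Fintype ι] {E : ι → Type*}
    [∀ i, MeasurableSpace (E i)] (T : ∀ i, Measure (E i)) [∀ i, SigmaFinite (T i)]
    (c : ι → ENNReal) [∀ i, SigmaFinite (c i • T i)] :
    (Measure.pi fun i => c i • T i) = (∏ i, c i) • Measure.pi T := by
  refine Measure.pi_eq fun s _ => ?_
  simp [Measure.pi_pi, Finset.prod_mul_distrib]

/-- Multiplying a Gaussian measure by a Gaussian kernel gives a multiple of a Gaussian measure. -/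
theorem gaussianReal_withDensity_exp {m x₀ σ ν : ℝ} (hσ : 0 < σ) (hν : 0 < ν) {σt : ℝ}
    (hσt : σt = ν * σ / √(ν ^ 2 + σ ^ 2)) {v vt : NNReal} (hv : (v : ℝ) = σ ^ 2)
    (hvt : (vt : ℝ) = σt ^ 2) :
    (gaussianReal m v).withDensity
        (fun x => ENNReal.ofReal (exp (-(x - x₀) ^ 2 / (2 * ν ^ 2)))) =
      ENNReal.ofReal (√(ν ^ 2 / (ν ^ 2 + σ ^ 2)) * exp (-(x₀ - m) ^ 2 / (2 * (ν ^ 2 + σ ^ 2)))) •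
        gaussianReal ((ν ^ 2 * m + σ ^ 2 * x₀) / (ν ^ 2 + σ ^ 2)) vt := by
  have hs : 0 < ν ^ 2 + σ ^ 2 := by positivity
  have hσt0 : 0 < σt := by rw [hσt]; positivity
  have hσt2 : σt ^ 2 = ν ^ 2 * σ ^ 2 / (ν ^ 2 + σ ^ 2) := by
    rw [hσt, div_pow, Real.sq_sqrt hs.le]; ring
  have hv0 : v ≠ 0 := by
    rintro rfl
    exact (pow_pos hσ 2).ne hv
  have hvt0 : vt ≠ 0 := by
    rintro rfl
    exact (pow_pos hσt0 2).ne hvt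
  rw [gaussianReal_of_var_ne_zero _ hv0, gaussianReal_of_var_ne_zero _ hvt0,
    ← withDensity_mul _ (measurable_gaussianPDF _ _) (by fun_prop),
    ← withDensity_smul _ (measurable_gaussianPDF _ _)]
  congr 1
  ext x
  simp only [Pi.mul_apply, Pi.smul_apply, smul_eq_mul, gaussianPDF, gaussianPDFReal]
  rw [← ENNReal.ofReal_mul (by positivity), ← ENNReal.ofReal_mul (by positivity), hv, hvt, hσt2]
  congr 1
  have h1 : ∀ p q r : ℝ, p * exp q * exp r = p * exp (q + r) :=
    fun p q r => by rw [exp_add]; ring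
  have h2 : ∀ p q r s : ℝ, p * exp q * (r * exp s) = p * r * exp (q + s) :=
    fun p q r s => by rw [exp_add]; ring
  rw [h1, h2]
  congr 1
  · rw [← Real.sqrt_inv, ← Real.sqrt_inv, ← Real.sqrt_mul (by positivity)]
    congr 1
    field_simp
  · congr 1
    field_simp
    ring

/-- Weighting a product Gaussian by an isotropic Gaussian kernel. -/
theorem pi_gaussianReal_withDensity_exp {d : ℕ} {m x₀ : Fin d → ℝ} {σ ν : ℝ} (hσ : 0 < σ)
    (hν : 0 < ν) {σt : ℝ} (hσt : σt = ν * σ / √(ν ^ 2 + σ ^ 2)) {v vt : NNReal}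
    (hv : (v : ℝ) = σ ^ 2) (hvt : (vt : ℝ) = σt ^ 2) {mt : Fin d → ℝ}
    (hmt : ∀ j, mt j = (ν ^ 2 * m j + σ ^ 2 * x₀ j) / (ν ^ 2 + σ ^ 2)) :
    (Measure.pi fun j => gaussianReal (m j) v).withDensity
        (fun x => ENNReal.ofReal (exp (-(∑ j, (x j - x₀ j) ^ 2) / (2 * ν ^ 2)))) =
      ENNReal.ofReal ((ν ^ 2 / (ν ^ 2 + σ ^ 2)) ^ ((d : ℝ) / 2) *
          exp (-(∑ j, (x₀ j - m j) ^ 2) / (2 * (ν ^ 2 + σ ^ 2)))) •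
        Measure.pi fun j => gaussianReal (mt j) vt := by
  have hexp : ∀ (y : Fin d → ℝ) (c : ℝ), exp (-(∑ j, (y j) ^ 2) / c) =
      ∏ j, exp (-(y j) ^ 2 / c) := by
    intro y c
    rw [← Real.exp_sum, ← Finset.sum_div, Finset.sum_neg_distrib]
  have hden : (fun x : Fin d → ℝ =>
      ENNReal.ofReal (exp (-(∑ j, (x j - x₀ j) ^ 2) / (2 * ν ^ 2)))) =
      fun x => ∏ j, ENNReal.ofReal (exp (-(x j - x₀ j) ^ 2 / (2 * ν ^ 2))) := by
    ext x
    rw [hexp (fun j => x j - x₀ j), ENNReal.ofReal_prod_of_nonneg fun _ _ => (exp_pos _).le]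
  have hpow : (ν ^ 2 / (ν ^ 2 + σ ^ 2)) ^ ((d : ℝ) / 2) = ∏ _j : Fin d,
      √(ν ^ 2 / (ν ^ 2 + σ ^ 2)) := by
    rw [Finset.prod_const, Finset.card_univ, Fintype.card_fin, Real.sqrt_eq_rpow,
      ← Real.rpow_mul_natCast (by positivity)]
    congr 1
    ring
  rw [hden, hpow, hexp (fun j => x₀ j - m j), ← Finset.prod_mul_distrib,
    ENNReal.ofReal_prod_of_nonneg fun _ _ => by positivity]
  have h1 := fun j => gaussianReal_withDensity_exp (m := m j) (x₀ := x₀ j) hσ hν hσt hv hvt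
  have hfin : ∀ j, IsFiniteMeasure ((gaussianReal (m j) v).withDensity
      (fun x => ENNReal.ofReal (exp (-(x - x₀ j) ^ 2 / (2 * ν ^ 2))))) := by
    intro j
    rw [h1 j]
    exact Measure.smul_finite _ ENNReal.ofReal_ne_top
  rw [pi_withDensity_prod (fun j => gaussianReal (m j) v)
    (fun j x => ENNReal.ofReal (exp (-(x - x₀ j) ^ 2 / (2 * ν ^ 2)))) fun j => by fun_prop]
  simp_rw [h1, ← hmt] at hfin ⊢
  exact pi_smul_eq_prod_smul_pi _ _

theorem integral_mul_of_withDensity_eq {E : Type*} [MeasurableSpace E] {Q T : Measure E}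
    {w : E → ℝ} {C : ℝ} (hw : Measurable w) (hw0 : ∀ x, 0 ≤ w x) (hC : 0 ≤ C)
    (hQT : Q.withDensity (fun x => ENNReal.ofReal (w x)) = ENNReal.ofReal C • T) (F : E → ℝ) :
    ∫ x, w x * F x ∂Q = C * ∫ x, F x ∂T := by
  have h := integral_withDensity_eq_integral_toReal_smul (μ := Q) hw.ennreal_ofReal
    (Filter.Eventually.of_forall fun x => ENNReal.ofReal_lt_top) F
  rw [hQT, integral_smul_measure, ENNReal.toReal_ofReal hC, smul_eq_mul] at h
  rw [h]
  exact integral_congr_ae (Filter.Eventually.of_forall fun x => by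
    simp [ENNReal.toReal_ofReal (hw0 x)])

theorem integrable_mul_of_withDensity_eq {E : Type*} [MeasurableSpace E] {Q T : Measure E}
    {w : E → ℝ} {C : ℝ} (hw : Measurable w) (hw0 : ∀ x, 0 ≤ w x)
    (hQT : Q.withDensity (fun x => ENNReal.ofReal (w x)) = ENNReal.ofReal C • T) {F : E → ℝ}
    (hF : Integrable F T) : Integrable (fun x => w x * F x) Q := by
  have h : Integrable F (Q.withDensity fun x => ENNReal.ofReal (w x)) := by
    rw [hQT]
    exact hF.smul_measure ENNReal.ofReal_ne_top
  rw [integrable_withDensity_iff_integrable_smul' hw.ennreal_ofReal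
    (Filter.Eventually.of_forall fun x => ENNReal.ofReal_lt_top)] at h
  exact h.congr (Filter.Eventually.of_forall fun x => by simp [ENNReal.toReal_ofReal (hw0 x)])

theorem exp_mul_le_one_add {w y : ℝ} (hw0 : 0 ≤ w) (hw1 : w ≤ 1) :
    exp (w * y) ≤ 1 + w * (exp y - 1) := by
  have h := convexOn_exp.2 (Set.mem_univ 0) (Set.mem_univ y) (sub_nonneg.2 hw1) hw0 (by ring)
  simp only [smul_eq_mul, mul_zero, zero_add, exp_zero, mul_one] at h
  linarith

theorem HasSubgaussianMGF.mono {Ω : Type*} [MeasurableSpace Ω] {μ : Measure Ω} {X : Ω → ℝ}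
    {c c' : NNReal} (h : HasSubgaussianMGF X c μ) (hc : c ≤ c') : HasSubgaussianMGF X c' μ where
  integrable_exp_mul := h.integrable_exp_mul
  mgf_le t := (h.mgf_le t).trans (exp_le_exp.2 (by gcongr))

/-- If `V` is sub-Gaussian under the law obtained by reweighting `Q` by `w ∈ [0, 1]`, then every
`w * U` with `|U| ≤ B * |V|` is sub-Gaussian under `Q` after centering. -/
theorem hasSubgaussianMGF_weighted_sub_integral {E : Type*} [MeasurableSpace E] {Q T : Measure E}
    [IsProbabilityMeasure Q] [IsProbabilityMeasure T]
    {w : E → ℝ} {C : ℝ} (hw : Measurable w) (hw0 : ∀ x, 0 ≤ w x) (hw1 : ∀ x, w x ≤ 1) (hC : 0 ≤ C)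
    (hC1 : C ≤ 1)
    (hQT : Q.withDensity (fun x => ENNReal.ofReal (w x)) = ENNReal.ofReal C • T)
    {U V : E → ℝ} (hU : Measurable U) {K : NNReal} (hV : HasSubgaussianMGF V K T) {B : NNReal}
    (hUV : ∀ x, |U x| ≤ B * |V x|) :
    HasSubgaussianMGF (fun x => w x * U x - ∫ x, w x * U x ∂Q) (4 * B ^ 2 * K) Q := by
  have hcosh : ∀ s x, exp (s * (w x * U x)) + exp (-(s * (w x * U x))) ≤
      2 + w x * (exp (s * B * V x) + exp (-(s * B) * V x) - 2) := by
    intro s x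
    have h1 : |s * (w x * U x)| ≤ |w x * (s * B * V x)| := by
      rw [abs_mul, abs_mul, abs_mul, abs_mul, abs_mul, abs_of_nonneg B.coe_nonneg]
      calc |s| * (|w x| * |U x|) ≤ |s| * (|w x| * (B * |V x|)) := by gcongr; exact hUV x
        _ = _ := by ring
    have h2 := Real.cosh_le_cosh.2 h1
    rw [Real.cosh_eq, Real.cosh_eq] at h2
    have h3 := exp_mul_le_one_add (y := s * B * V x) (hw0 x) (hw1 x)
    have h4 := exp_mul_le_one_add (y := -(s * B) * V x) (hw0 x) (hw1 x)
    rw [show w x * (-(s * B) * V x) = -(w x * (s * B * V x)) by ring] at h4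
    linarith
  have hVint : ∀ s, Integrable (fun x => exp (s * V x)) T := hV.integrable_exp_mul
  have hdom : ∀ s, Integrable
      (fun x => 2 + w x * (exp (s * B * V x) + exp (-(s * B) * V x) - 2)) Q := fun s =>
    (integrable_const _).add (integrable_mul_of_withDensity_eq hw hw0 hQT
      (((hVint _).add (hVint _)).sub (integrable_const _)))
  have hexp_int : ∀ s, Integrable (fun x => exp (s * (w x * U x))) Q := by
    intro s
    refine (hdom s).mono' (by fun_prop) (Filter.Eventually.of_forall fun x => ?_)
    rw [Real.norm_of_nonneg (exp_pos _).le]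
    linarith [hcosh s x, exp_pos (-(s * (w x * U x)))]
  have hUint : Integrable (fun x => w x * U x) Q :=
    integrable_of_mem_interior_integrableExpSet (by
      rw [show integrableExpSet (fun x => w x * U x) Q = Set.univ from
        Set.eq_univ_of_forall fun s => hexp_int s]
      simp)
  set m := ∫ x, w x * U x ∂Q with hm
  refine ⟨fun t => ?_, fun t => ?_⟩
  · simp_rw [mul_sub, sub_eq_add_neg, exp_add]
    exact (hexp_int t).mul_const _
  · have hjensen : exp (-(2 * t) * m) ≤ ∫ x, exp (-(2 * t) * (w x * U x)) ∂Q := by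
      rw [hm, ← integral_const_mul]
      exact convexOn_exp.map_integral_le continuous_exp.continuousOn isClosed_univ
        (Filter.Eventually.of_forall fun _ => Set.mem_univ _) (hUint.const_mul _) (hexp_int _)
    have hpt : ∀ x, exp (t * (w x * U x - m)) ≤
        (exp (2 * t * (w x * U x)) + exp (-(2 * t) * m)) / 2 := by
      intro x
      have h1 := sq_nonneg (exp (t * (w x * U x)) - exp (-t * m))
      have h2 : exp (t * (w x * U x - m)) = exp (t * (w x * U x)) * exp (-t * m) := by
        rw [← exp_add]; ring_nf
      have h3 : exp (2 * t * (w x * U x)) = exp (t * (w x * U x)) ^ 2 := by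
        rw [← exp_nat_mul]; push_cast; ring_nf
      have h4 : exp (-(2 * t) * m) = exp (-t * m) ^ 2 := by
        rw [← exp_nat_mul]; push_cast; ring_nf
      rw [h2, h3, h4]
      linarith
    have hmgf : ∀ s, ∫ x, exp (s * V x) ∂T ≤ exp (K * s ^ 2 / 2) := hV.mgf_le
    calc mgf (fun x => w x * U x - m) Q t
        = ∫ x, exp (t * (w x * U x - m)) ∂Q := rfl
      _ ≤ ∫ x, (exp (2 * t * (w x * U x)) + exp (-(2 * t) * m)) / 2 ∂Q :=
          integral_mono_of_nonneg (Filter.Eventually.of_forall fun _ => (exp_pos _).le)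
            (((hexp_int _).add (integrable_const _)).div_const _) (Filter.Eventually.of_forall hpt)
      _ = (∫ x, exp (2 * t * (w x * U x)) ∂Q + exp (-(2 * t) * m)) / 2 := by
          rw [integral_div, integral_add (hexp_int _) (integrable_const _)]
          simp
      _ ≤ (∫ x, exp (2 * t * (w x * U x)) ∂Q + ∫ x, exp (-(2 * t) * (w x * U x)) ∂Q) / 2 := by
          gcongr
      _ = (∫ x, (exp (2 * t * (w x * U x)) + exp (-(2 * t * (w x * U x)))) ∂Q) / 2 := by
          rw [← integral_add (hexp_int _) (hexp_int _)]
          simp_rw [neg_mul]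
      _ ≤ (∫ x, (2 + w x * (exp (2 * t * B * V x) + exp (-(2 * t * B) * V x) - 2)) ∂Q) / 2 := by
          refine div_le_div_of_nonneg_right ?_ zero_le_two
          exact integral_mono_of_nonneg (Filter.Eventually.of_forall fun _ => by positivity)
            (hdom _) (Filter.Eventually.of_forall fun x => hcosh _ x)
      _ = 1 + C * ((∫ x, exp (2 * t * B * V x) ∂T + ∫ x, exp (-(2 * t * B) * V x) ∂T) / 2 - 1) := by
          have hsum : Integrable
              (fun x => exp (2 * t * B * V x) + exp (-(2 * t * B) * V x)) T :=
            (hVint _).add (hVint _)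
          have hsub : Integrable
              (fun x => exp (2 * t * B * V x) + exp (-(2 * t * B) * V x) - 2) T :=
            hsum.sub (integrable_const _)
          rw [integral_add (integrable_const _)
              (integrable_mul_of_withDensity_eq hw hw0 hQT hsub),
            integral_mul_of_withDensity_eq hw hw0 hC hQT, integral_sub hsum (integrable_const _),
            integral_add (hVint _) (hVint _), integral_const, integral_const]
          simp only [probReal_univ, smul_eq_mul]
          ring
      _ ≤ 1 + C * (exp (((4 * B ^ 2 * K : NNReal) : ℝ) * t ^ 2 / 2) - 1) := by
          have h1 := hmgf (2 * t * B)
          have h2 := hmgf (-(2 * t * B))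
          rw [neg_sq] at h2
          have h3 : (K : ℝ) * (2 * t * B) ^ 2 / 2 = ((4 * B ^ 2 * K : NNReal) : ℝ) * t ^ 2 / 2 := by
            push_cast; ring
          rw [h3] at h1 h2
          gcongr
          linarith
      _ ≤ exp (((4 * B ^ 2 * K : NNReal) : ℝ) * t ^ 2 / 2) := by
          have h1 : 1 ≤ exp (((4 * B ^ 2 * K : NNReal) : ℝ) * t ^ 2 / 2) := one_le_exp (by positivity)
          nlinarith

/-- Two-sided Hoeffding bound for the empirical mean of i.i.d. sub-Gaussian variables. -/
theorem pi_measureReal_abs_mean_ge_le {E : Type*} [MeasurableSpace E] {Q : Measure E}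
    [IsProbabilityMeasure Q] {Y : E → ℝ} (hYm : Measurable Y) {c : NNReal}
    (hY : HasSubgaussianMGF Y c Q) {n : ℕ} (hn : 1 ≤ n) {s : ℝ} (hs : 0 ≤ s) :
    (Measure.pi fun _ : Fin n => Q).real {ω | s ≤ |(n : ℝ)⁻¹ * ∑ i, Y (ω i)|} ≤
      2 * exp (-(n * s ^ 2) / (2 * c)) := by
  have hn0 : (0 : ℝ) < n := by exact_mod_cast hn
  have tail : ∀ Z : E → ℝ, Measurable Z → HasSubgaussianMGF Z c Q →
      (Measure.pi fun _ : Fin n => Q).real {ω | n * s ≤ ∑ i, Z (ω i)} ≤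
        exp (-(n * s ^ 2) / (2 * c)) := by
    intro Z hZm hZ
    have h := HasSubgaussianMGF.measure_sum_ge_le_of_iIndepFun (s := Finset.univ)
      (c := fun _ => c) (iIndepFun_pi (μ := fun _ : Fin n => Q) (X := fun _ => Z)
        fun _ => hZm.aemeasurable)
      (fun i _ => HasSubgaussianMGF.of_map (Y := Function.eval i) (X := Z)
        (measurable_pi_apply i).aemeasurable
        (by rwa [(measurePreserving_eval (fun _ : Fin n => Q) i).map_eq])) (ε := n * s)
      (by positivity)
    refine h.trans_eq ?_
    congr 1
    simp only [Finset.sum_const, Finset.card_univ, Fintype.card_fin, nsmul_eq_mul,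
      NNReal.coe_mul, NNReal.coe_natCast]
    field_simp
  have hsub : {ω : Fin n → E | s ≤ |(n : ℝ)⁻¹ * ∑ i, Y (ω i)|} ⊆
      {ω | n * s ≤ ∑ i, Y (ω i)} ∪ {ω | n * s ≤ ∑ i, (-Y) (ω i)} := by
    intro ω hω
    simp only [Set.mem_ofPred_eq, Set.mem_union, Pi.neg_apply, Finset.sum_neg_distrib] at hω ⊢
    rw [abs_mul, abs_of_pos (inv_pos.2 hn0), ← div_eq_inv_mul, le_div_iff₀' hn0] at hω
    exact le_abs.1 hω
  calc _ ≤ _ := measureReal_mono hsub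
    _ ≤ _ := measureReal_union_le _ _
    _ ≤ _ := add_le_add (tail Y hYm hY) (tail (-Y) hYm.neg hY.neg)
    _ = _ := by ring

/-- Features with intercept, standardized coordinatewise as if they were independent Bernoulli
variables with means `α j`. -/
noncomputable def standardize {d : ℕ} (α : Fin d → ℝ) (z : Fin (d + 1) → ℝ) : Fin (d + 1) → ℝ :=
  Fin.cons 1 fun j => (z j.succ - α j) / √(α j * (1 - α j))

/-- The coefficients with respect to standardized features of the linear form with
coefficients `v`. -/
noncomputable def standardizeCoeff {d : ℕ} (α : Fin d → ℝ) (v : Fin (d + 1) → ℝ) :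
    Fin (d + 1) → ℝ :=
  Fin.cons (v 0 + ∑ j, α j * v j.succ) fun j => √(α j * (1 - α j)) * v j.succ

theorem standardize_dotProduct_standardizeCoeff {d : ℕ} {α : Fin d → ℝ}
    (hα : ∀ j, 0 < α j ∧ α j < 1) {z : Fin (d + 1) → ℝ} (hz : z 0 = 1) (v : Fin (d + 1) → ℝ) :
    ∑ k, standardize α z k * standardizeCoeff α v k = ∑ k, z k * v k := by
  simp only [standardize, standardizeCoeff, Fin.sum_univ_succ, Fin.cons_zero, Fin.cons_succ, hz,
    one_mul, add_assoc, ← Finset.sum_add_distrib]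
  congr 1
  refine Finset.sum_congr rfl fun j _ => ?_
  have : 0 < √(α j * (1 - α j)) :=
    Real.sqrt_pos.2 (mul_pos (hα j).1 (sub_pos.2 (hα j).2))
  field_simp
  ring

theorem sum_sq_le_sum_sq_standardizeCoeff {d : ℕ} (hd : 1 ≤ d) {α : Fin d → ℝ}
    (hα : ∀ j, 0 < α j ∧ α j < 1) {A : ℝ} (hA : ∀ j, 1 / (α j * (1 - α j)) ≤ A)
    (v : Fin (d + 1) → ℝ) :
    ∑ k, v k ^ 2 ≤ 2 * d * A * ∑ k, standardizeCoeff α v k ^ 2 := by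
  have hd1 : (1 : ℝ) ≤ d := by exact_mod_cast hd
  have hD : ∀ j, 0 < α j * (1 - α j) := fun j => mul_pos (hα j).1 (sub_pos.2 (hα j).2)
  have hA0 : 0 < A := (one_div_pos.2 (hD ⟨0, hd⟩)).trans_le (hA _)
  set w := standardizeCoeff α v with hw
  have hw0 : w 0 = v 0 + ∑ j, α j * v j.succ := rfl
  have hws : ∀ j : Fin d, w j.succ = √(α j * (1 - α j)) * v j.succ := fun j => rfl
  have htail : ∑ j : Fin d, v j.succ ^ 2 ≤ A * ∑ k, w k ^ 2 := by
    calc ∑ j : Fin d, v j.succ ^ 2 ≤ ∑ j : Fin d, A * w j.succ ^ 2 := by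
          refine Finset.sum_le_sum fun j _ => ?_
          rw [hws, mul_pow, Real.sq_sqrt (hD j).le, ← mul_assoc]
          have := (div_le_iff₀ (hD j)).1 (hA j)
          nlinarith [sq_nonneg (v j.succ)]
      _ = A * ∑ j : Fin d, w j.succ ^ 2 := by rw [Finset.mul_sum]
      _ ≤ A * ∑ k, w k ^ 2 := by
          rw [Fin.sum_univ_succ]
          gcongr
          nlinarith [sq_nonneg (w 0)]
  have hhead : v 0 ^ 2 ≤ (1 + d * (A - 1)) * ∑ k, w k ^ 2 := by
    set g : Fin (d + 1) → ℝ := Fin.cons 1 fun j => -(α j / √(α j * (1 - α j))) with hg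
    have h0 : v 0 = ∑ k, g k * w k := by
      simp only [hg, Fin.sum_univ_succ, Fin.cons_zero, Fin.cons_succ, hw0, hws, one_mul]
      rw [add_assoc, ← Finset.sum_add_distrib, Finset.sum_eq_zero, add_zero]
      intro j _
      have : 0 < √(α j * (1 - α j)) := Real.sqrt_pos.2 (hD j)
      field_simp
      ring
    have hgs : ∑ k, g k ^ 2 ≤ 1 + d * (A - 1) := by
      simp only [hg, Fin.sum_univ_succ, Fin.cons_zero, Fin.cons_succ, one_pow]
      gcongr
      calc ∑ j : Fin d, (-(α j / √(α j * (1 - α j)))) ^ 2 ≤ ∑ _j : Fin d, (A - 1) := by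
            refine Finset.sum_le_sum fun j _ => ?_
            rw [neg_sq, div_pow, Real.sq_sqrt (hD j).le]
            have h1 := (div_le_iff₀ (hD j)).1 (hA j)
            rw [div_le_iff₀ (hD j)]
            nlinarith [(hα j).1, (hα j).2]
        _ = d * (A - 1) := by simp; ring
    rw [h0]
    refine (Finset.sum_mul_sq_le_sq_mul_sq _ g w).trans ?_
    gcongr
  have hN : 0 ≤ ∑ k, w k ^ 2 := Finset.sum_nonneg fun _ _ => sq_nonneg _
  rw [Fin.sum_univ_succ]
  calc _ ≤ (1 + d * (A - 1) + A) * ∑ k, w k ^ 2 := by linarith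
    _ ≤ _ := by
      gcongr
      nlinarith

theorem quadratic_form_ge_of_entrywise_close {m : ℕ} {G : Fin (m + 1) → Fin (m + 1) → ℝ} {C : ℝ}
    (hG : ∀ k l, |G k l - if k = l then C else 0| ≤ 2 * C / (3 * (m + 1)))
    (w : Fin (m + 1) → ℝ) :
    C / 3 * ∑ k, w k ^ 2 ≤ ∑ k, ∑ l, w k * w l * G k l := by
  set t := 2 * C / (3 * (m + 1)) with ht
  have ht0 : 0 ≤ t := (abs_nonneg _).trans (hG 0 0)
  have h1 : ∀ k l, (if k = l then C * w k ^ 2 else 0) - t * (|w k| * |w l|) ≤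
      w k * w l * G k l := by
    intro k l
    have h2 : |w k * w l * (G k l - if k = l then C else 0)| ≤ t * (|w k| * |w l|) := by
      rw [abs_mul, abs_mul, mul_comm]
      gcongr
      exact hG k l
    have h3 := (abs_le.1 h2).1
    split_ifs at h3 ⊢ with hkl
    · subst hkl; nlinarith
    · nlinarith
  calc C / 3 * ∑ k, w k ^ 2 = C * ∑ k, w k ^ 2 - t * ((m + 1) * ∑ k, w k ^ 2) := by
        rw [ht]; field_simp; ring
    _ ≤ C * ∑ k, w k ^ 2 - t * (∑ k, |w k|) ^ 2 := by
        have := sq_sum_le_card_mul_sum_sq (s := Finset.univ) (f := fun k => |w k|)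
        simp only [Finset.card_univ, Fintype.card_fin, sq_abs] at this
        push_cast at this
        gcongr
    _ = ∑ k, ∑ l, ((if k = l then C * w k ^ 2 else 0) - t * (|w k| * |w l|)) := by
        simp only [Finset.sum_sub_distrib, Finset.sum_ite_eq, Finset.mem_univ, if_true,
          ← Finset.mul_sum, sq (∑ k, |w k|), Finset.sum_mul]
    _ ≤ _ := Finset.sum_le_sum fun k _ => Finset.sum_le_sum fun l _ => h1 k l

/-- Deterministic error bound for weighted least squares: if the standardized empirical second
moments are close to `C` times the identity and the standardized empirical residual correlations
are small, then the coefficients are close to `β`. -/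
theorem weighted_least_squares_error {d n : ℕ} (hd : 1 ≤ d) {α : Fin d → ℝ}
    (hα : ∀ j, 0 < α j ∧ α j < 1) {A : ℝ} (hA : ∀ j, 1 / (α j * (1 - α j)) ≤ A)
    {C : ℝ} (hC : 0 < C) {p y : Fin n → ℝ} {Z : Fin n → Fin (d + 1) → ℝ} (hZ : ∀ i, Z i 0 = 1)
    {β : Fin (d + 1) → ℝ} {a : Fin d → ℝ} {H : Fin n → Fin d → ℝ}
    (hres : ∀ i, y i - ∑ k, Z i k * β k = ∑ j, a j * H i j)
    {S : Matrix (Fin (d + 1)) (Fin (d + 1)) ℝ}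
    (hS : S = (n : ℝ)⁻¹ • ∑ i, p i • Matrix.vecMulVec (Z i) (Z i))
    {Γ : Fin (d + 1) → ℝ} (hΓ : Γ = (n : ℝ)⁻¹ • ∑ i, (p i * y i) • Z i)
    (hG : ∀ k l, |(n : ℝ)⁻¹ * ∑ i, p i * (standardize α (Z i) k * standardize α (Z i) l) -
      if k = l then C else 0| ≤ 2 * C / (3 * (d + 1)))
    {s : ℝ} (hV : ∀ k j, |(n : ℝ)⁻¹ * ∑ i, p i * (standardize α (Z i) k * H i j)| ≤ s)
    {ε : ℝ} (hε : 0 ≤ ε) (hs : 36 * d ^ 3 * A * s ^ 2 * ∑ j, a j ^ 2 ≤ C ^ 2 * ε ^ 2) :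
    IsUnit S ∧ √(∑ k, (S⁻¹.mulVec Γ k - β k) ^ 2) ≤ ε := by
  have hd1 : (1 : ℝ) ≤ d := by exact_mod_cast hd
  have hA0 : 0 < A :=
    (one_div_pos.2 (mul_pos (hα ⟨0, hd⟩).1 (sub_pos.2 (hα ⟨0, hd⟩).2))).trans_le (hA _)
  have hSv : ∀ v k, S.mulVec v k = (n : ℝ)⁻¹ * ∑ i, p i * (∑ l, Z i l * v l) * Z i k := by
    intro v k
    rw [hS, Matrix.smul_mulVec, Pi.smul_apply, smul_eq_mul, Matrix.sum_mulVec, Finset.sum_apply]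
    congr 1
    refine Finset.sum_congr rfl fun i _ => ?_
    rw [Matrix.smul_mulVec, Pi.smul_apply, smul_eq_mul, Matrix.vecMulVec_mulVec]
    simp [dotProduct]
    ring
  have hform : ∀ v : Fin (d + 1) → ℝ, ∀ q : Fin n → ℝ,
      ∑ k, v k * ((n : ℝ)⁻¹ * ∑ i, q i * Z i k) = ∑ k, standardizeCoeff α v k *
        ((n : ℝ)⁻¹ * ∑ i, q i * standardize α (Z i) k) := by
    intro v q
    have key : ∀ (x : Fin (d + 1) → ℝ) (Y : Fin n → Fin (d + 1) → ℝ),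
        ∑ k, x k * ((n : ℝ)⁻¹ * ∑ i, q i * Y i k) = (n : ℝ)⁻¹ * ∑ i, q i * ∑ k, Y i k * x k := by
      intro x Y
      simp only [Finset.mul_sum]
      rw [Finset.sum_comm]
      exact Finset.sum_congr rfl fun i _ => Finset.sum_congr rfl fun k _ => by ring
    rw [key, key]
    simp_rw [standardize_dotProduct_standardizeCoeff hα (hZ _)]
  have hquad : ∀ v, C / 3 * ∑ k, standardizeCoeff α v k ^ 2 ≤ ∑ k, v k * S.mulVec v k := by
    intro v
    simp_rw [hSv v, hform v (fun i => p i * ∑ l, Z i l * v l),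
      ← standardize_dotProduct_standardizeCoeff hα (hZ _)]
    refine (quadratic_form_ge_of_entrywise_close hG _).trans_eq ?_
    refine Finset.sum_congr rfl fun k _ => ?_
    simp only [Finset.mul_sum, Finset.sum_mul]
    rw [Finset.sum_comm]
    exact Finset.sum_congr rfl fun i _ => Finset.sum_congr rfl fun l _ => by ring
  have hunit : IsUnit S := by
    rw [← Matrix.mulVec_injective_iff_isUnit]
    refine (injective_iff_map_eq_zero S.mulVecLin).2 fun v hv => ?_
    have h1 := hquad v
    have hv' : S.mulVec v = 0 := hv
    simp only [hv', Pi.zero_apply, mul_zero, Finset.sum_const_zero] at h1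
    have h2 := sum_sq_le_sum_sq_standardizeCoeff hd hα hA v
    have h3 : ∑ k, standardizeCoeff α v k ^ 2 ≤ 0 := by
      by_contra! h
      nlinarith [mul_pos hC h]
    have h4 : ∑ k, v k ^ 2 ≤ 0 := h2.trans (mul_nonpos_of_nonneg_of_nonpos (by positivity) h3)
    ext k
    have h5 := Finset.single_le_sum (f := fun k => v k ^ 2) (fun k _ => sq_nonneg (v k))
      (Finset.mem_univ k)
    exact pow_eq_zero_iff two_ne_zero |>.1 (le_antisymm (h5.trans h4) (sq_nonneg _))
  refine ⟨hunit, ?_⟩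
  set v : Fin (d + 1) → ℝ := fun k => S⁻¹.mulVec Γ k - β k with hv
  set w := standardizeCoeff α v with hw
  set R : Fin (d + 1) → ℝ := fun k => ∑ j, a j *
    ((n : ℝ)⁻¹ * ∑ i, p i * (standardize α (Z i) k * H i j)) with hR
  have hSv' : S.mulVec v = Γ - S.mulVec β := by
    have : v = S⁻¹.mulVec Γ - β := rfl
    rw [this, Matrix.mulVec_sub, Matrix.mulVec_mulVec,
      Matrix.mul_nonsing_inv _ ((Matrix.isUnit_iff_isUnit_det S).1 hunit), Matrix.one_mulVec]
  have hvR : ∑ k, v k * S.mulVec v k = ∑ k, w k * R k := by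
    have h1 : ∀ k, S.mulVec v k = (n : ℝ)⁻¹ * ∑ i, (p i * ∑ j, a j * H i j) * Z i k := by
      intro k
      rw [hSv', Pi.sub_apply, hSv, hΓ, Pi.smul_apply, smul_eq_mul, Finset.sum_apply, ← mul_sub,
        ← Finset.sum_sub_distrib]
      congr 1
      refine Finset.sum_congr rfl fun i _ => ?_
      rw [← hres i, Pi.smul_apply, smul_eq_mul]
      ring
    simp_rw [h1]
    rw [hform]
    refine Finset.sum_congr rfl fun k _ => ?_
    simp only [hR, Finset.mul_sum, Finset.sum_mul]
    rw [Finset.sum_comm]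
    exact Finset.sum_congr rfl fun j _ => Finset.sum_congr rfl fun i _ => by ring
  have hRk : ∀ k, R k ^ 2 ≤ (∑ j, a j ^ 2) * (d * s ^ 2) := by
    intro k
    refine (Finset.sum_mul_sq_le_sq_mul_sq _ _ _).trans ?_
    gcongr
    calc _ ≤ ∑ _j : Fin d, s ^ 2 := Finset.sum_le_sum fun j _ => sq_le_sq.2
            ((hV k j).trans (le_abs_self s))
      _ = d * s ^ 2 := by simp
  have hR2 : ∑ k, R k ^ 2 ≤ (d + 1) * ((∑ j, a j ^ 2) * (d * s ^ 2)) := by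
    refine (Finset.sum_le_sum fun k _ => hRk k).trans_eq ?_
    simp
  set N := ∑ k, w k ^ 2 with hN
  have hN0 : 0 ≤ N := Finset.sum_nonneg fun _ _ => sq_nonneg _
  have hNR : C ^ 2 / 9 * N ≤ ∑ k, R k ^ 2 := by
    have h1 : C / 3 * N ≤ ∑ k, w k * R k := hvR ▸ hquad v
    have h2 : (C / 3 * N) ^ 2 ≤ N * ∑ k, R k ^ 2 :=
      (pow_le_pow_left₀ (by positivity) h1 2).trans (Finset.sum_mul_sq_le_sq_mul_sq _ _ _)
    rcases hN0.eq_or_lt with h0 | h0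
    · rw [← h0, mul_zero]
      exact Finset.sum_nonneg fun _ _ => sq_nonneg _
    · refine le_of_mul_le_mul_left ?_ h0
      linarith
  rw [Real.sqrt_le_left hε]
  refine (sum_sq_le_sum_sq_standardizeCoeff hd hα hA v).trans ?_
  have ha0 : 0 ≤ ∑ j, a j ^ 2 := Finset.sum_nonneg fun _ _ => sq_nonneg _
  have hfin : C ^ 2 * N ≤ 18 * d ^ 2 * s ^ 2 * ∑ j, a j ^ 2 := by
    have : (d + 1 : ℝ) * ((∑ j, a j ^ 2) * (d * s ^ 2)) ≤
        (2 * d) * ((∑ j, a j ^ 2) * (d * s ^ 2)) := by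
      gcongr
      linarith
    linarith
  refine le_of_mul_le_mul_left ?_ (pow_pos hC 2)
  calc C ^ 2 * (2 * d * A * N) = 2 * d * A * (C ^ 2 * N) := by ring
    _ ≤ 2 * d * A * (18 * d ^ 2 * s ^ 2 * ∑ j, a j ^ 2) := by gcongr
    _ = 36 * d ^ 3 * A * s ^ 2 * ∑ j, a j ^ 2 := by ring
    _ ≤ _ := hs

theorem integral_indicator_mul_gaussianReal {m s : ℝ} (hs : 0 < s) {v : NNReal}
    (hv : (v : ℝ) = s ^ 2) {p q : ℝ} (hpq : p ≤ q) (F : ℝ → ℝ) :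
    ∫ x, (if p ≤ x ∧ x < q then (1 : ℝ) else 0) * F x ∂gaussianReal m v =
      ∫ x in p..q, exp (-(x - m) ^ 2 / (2 * s ^ 2)) / (s * √(2 * π)) * F x := by
  have hv0 : v ≠ 0 := by
    rintro rfl
    rw [NNReal.coe_zero] at hv
    exact (pow_pos hs 2).ne hv
  have hsqrt : √(2 * π * s ^ 2) = s * √(2 * π) := by
    rw [Real.sqrt_mul (by positivity), Real.sqrt_sq hs.le, mul_comm]
  rw [integral_gaussianReal_eq_integral_smul hv0, intervalIntegral.integral_of_le hpq,
    ← integral_Ico_eq_integral_Ioc, ← integral_indicator measurableSet_Ico]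
  congr 1
  ext x
  by_cases hx : p ≤ x ∧ x < q
  · rw [Set.indicator_of_mem (show x ∈ Set.Ico p q from hx), if_pos hx, one_mul, smul_eq_mul,
      gaussianPDFReal_def, hv]
    simp only [hsqrt]
    ring
  · rw [Set.indicator_of_notMem (show x ∉ Set.Ico p q from hx), if_neg hx, zero_mul, smul_zero]

theorem integral_indicator_mul_sub_gaussianReal {m s : ℝ} (hs : 0 < s) {v : NNReal}
    (hv : (v : ℝ) = s ^ 2) {p q : ℝ} (hpq : p ≤ q) :
    ∫ x, (if p ≤ x ∧ x < q then (1 : ℝ) else 0) * (x - m) ∂gaussianReal m v =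
      -(s / √(2 * π) * (exp (-(q - m) ^ 2 / (2 * s ^ 2)) - exp (-(p - m) ^ 2 / (2 * s ^ 2)))) := by
  have hpi : 0 < √(2 * π) := by positivity
  rw [integral_indicator_mul_gaussianReal hs hv hpq,
    intervalIntegral.integral_eq_sub_of_hasDerivAt
      (f := fun x => -(s / √(2 * π)) * exp (-(x - m) ^ 2 / (2 * s ^ 2)))]
  · ring
  · intro x _
    have h := ((((((hasDerivAt_id x).sub_const m).pow 2).neg).div_const (2 * s ^ 2)).exp).const_mul
      (-(s / √(2 * π)))
    refine h.congr_deriv ?_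
    simp only [Pi.neg_apply, Pi.pow_apply, id_eq]
    field_simp
    norm_num
  · exact (by fun_prop : Continuous fun x : ℝ =>
      exp (-(x - m) ^ 2 / (2 * s ^ 2)) / (s * √(2 * π)) * (x - m)).intervalIntegrable _ _

theorem integral_pi_eval_mul_eval {ι : Type*} [Fintype ι] {τ : ι → Measure ℝ}
    [∀ i, IsProbabilityMeasure (τ i)] {F G : ℝ → ℝ} (hF : Measurable F) (hG : Measurable G)
    {j k : ι} (hjk : j ≠ k) :
    ∫ x, F (x j) * G (x k) ∂Measure.pi τ = (∫ t, F t ∂τ j) * ∫ t, G t ∂τ k := by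
  have hind : IndepFun (fun x : ι → ℝ => x j) (fun x => x k) (Measure.pi τ) :=
    (iIndepFun_pi (X := fun _ t => t) fun _ => aemeasurable_id).indepFun hjk
  have h := (hind.comp hF hG).integral_fun_mul_eq_mul_integral
    (hF.comp (measurable_pi_apply j)).aestronglyMeasurable
    (hG.comp (measurable_pi_apply k)).aestronglyMeasurable
  simp only [Function.comp_apply] at h
  rw [h, integral_comp_eval hF.aestronglyMeasurable, integral_comp_eval hG.aestronglyMeasurable]

theorem hasSubgaussianMGF_pi_gaussianReal_eval {ι : Type*} [Fintype ι] (m : ι → ℝ) (v : NNReal)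
    (j : ι) :
    HasSubgaussianMGF (fun x : ι → ℝ => x j - m j) v
      (Measure.pi fun j => gaussianReal (m j) v) := by
  have h : Measure.map (fun x : ι → ℝ => x j - m j) (Measure.pi fun j => gaussianReal (m j) v) =
      gaussianReal 0 v := by
    have hsub : MeasurePreserving (fun t => t - m j) (gaussianReal (m j) v) (gaussianReal 0 v) :=
      ⟨by fun_prop, by rw [gaussianReal_map_sub_const, sub_self]⟩
    exact (hsub.comp (measurePreserving_eval (fun j => gaussianReal (m j) v) j)).map_eq
  constructor
  · intro t
    refine MeasureTheory.Integrable.comp_measurable (g := fun y => exp (t * y)) ?_ (by fun_prop)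
    rw [h]
    exact integrable_exp_mul_gaussianReal t
  · intro t
    rw [mgf_gaussianReal h]
    simp

theorem inv_mulVec_eq_of_bernoulli_covariance {d : ℕ} {α c : Fin d → ℝ}
    (hα : ∀ j, 0 < α j ∧ α j < 1) {C F : ℝ} (hC : C ≠ 0)
    {S : Matrix (Fin (d + 1)) (Fin (d + 1)) ℝ} (hS00 : S 0 0 = C)
    (hS0j : ∀ j : Fin d, S 0 j.succ = C * α j) (hSj0 : ∀ j : Fin d, S j.succ 0 = C * α j)
    (hSjj : ∀ j : Fin d, S j.succ j.succ = C * α j)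
    (hSjk : ∀ j k : Fin d, j ≠ k → S j.succ k.succ = C * α j * α k)
    {Γ : Fin (d + 1) → ℝ} (hΓ0 : Γ 0 = C * F) (hΓj : ∀ j : Fin d, Γ j.succ = C * (α j * F - c j)) :
    S⁻¹.mulVec Γ = Fin.cons (F + ∑ j, c j / (1 - α j)) fun j => -c j / (α j * (1 - α j)) := by
  have h0 : ∀ v, S.mulVec v 0 = C * (v 0 + ∑ j, α j * v j.succ) := by
    intro v
    simp only [Matrix.mulVec, dotProduct, Fin.sum_univ_succ, hS00, hS0j, mul_add, Finset.mul_sum,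
      mul_assoc]
  have hs : ∀ v (j : Fin d), S.mulVec v j.succ =
      α j * S.mulVec v 0 + C * (α j * (1 - α j) * v j.succ) := by
    intro v j
    have hrow : ∀ k : Fin d, S j.succ k.succ * v k.succ =
        α j * (C * (α k * v k.succ)) +
          if k = j then C * (α j * (1 - α j) * v j.succ) else 0 := by
      intro k
      split_ifs with hkj
      · subst hkj
        rw [hSjj]
        ring
      · rw [hSjk j k (Ne.symm hkj)]
        ring
    rw [h0]
    simp only [Matrix.mulVec, dotProduct, Fin.sum_univ_succ, hSj0, hrow, Finset.sum_add_distrib,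
      Finset.sum_ite_eq', Finset.mem_univ, if_true, ← Finset.mul_sum]
    ring
  have hD : ∀ j, α j * (1 - α j) ≠ 0 := fun j => (mul_pos (hα j).1 (sub_pos.2 (hα j).2)).ne'
  have hunit : IsUnit S := by
    rw [← Matrix.mulVec_injective_iff_isUnit]
    intro v v' hvv
    have htail : ∀ j : Fin d, v j.succ = v' j.succ := by
      intro j
      have h := congrFun hvv j.succ
      rw [hs, hs, congrFun hvv 0] at h
      exact mul_left_cancel₀ (hD j) (mul_left_cancel₀ hC (add_left_cancel h))
    have hhead := congrFun hvv 0
    rw [h0, h0] at hhead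
    simp only [htail] at hhead
    ext k
    refine Fin.cases (add_right_cancel (mul_left_cancel₀ hC hhead)) htail k
  set β : Fin (d + 1) → ℝ :=
    Fin.cons (F + ∑ j, c j / (1 - α j)) fun j => -c j / (α j * (1 - α j)) with hβ
  have hβ0 : S.mulVec β 0 = C * F := by
    rw [h0]
    simp only [hβ, Fin.cons_zero, Fin.cons_succ]
    rw [add_assoc, ← Finset.sum_add_distrib, Finset.sum_eq_zero, add_zero]
    intro j _
    have := (hα j).1.ne'
    have := (sub_pos.2 (hα j).2).ne'
    field_simp
    ring
  have hSβ : S.mulVec β = Γ := by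
    ext k
    refine Fin.cases ?_ (fun j => ?_) k
    · rw [hβ0, hΓ0]
    · rw [hs, hβ0, hΓj]
      simp only [hβ, Fin.cons_succ]
      rw [mul_div_cancel₀ _ (hD j)]
      ring
  rw [← hSβ, Matrix.mulVec_mulVec, Matrix.nonsing_inv_mul _ ((Matrix.isUnit_iff_isUnit_det _).1
    hunit), Matrix.one_mulVec]

/-- The indicator of `[p, q)`, standardized as a Bernoulli variable with mean `α`. -/
noncomputable def standardizedIndicator (p q α t : ℝ) : ℝ :=
  ((if p ≤ t ∧ t < q then (1 : ℝ) else 0) - α) / √(α * (1 - α))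

theorem measurable_indicator_Ico (p q : ℝ) :
    Measurable fun t : ℝ => if p ≤ t ∧ t < q then (1 : ℝ) else 0 :=
  Measurable.ite measurableSet_Ico measurable_const measurable_const

theorem measurable_standardizedIndicator (p q α : ℝ) :
    Measurable (standardizedIndicator p q α) :=
  ((measurable_indicator_Ico p q).sub_const α).div_const _

theorem abs_standardizedIndicator_le {p q α A : ℝ} (hα : 0 < α ∧ α < 1)
    (hA : 1 / (α * (1 - α)) ≤ A) (t : ℝ) : |standardizedIndicator p q α t| ≤ √A := by
  have hD : 0 < α * (1 - α) := mul_pos hα.1 (sub_pos.2 hα.2)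
  rw [← Real.sqrt_sq_eq_abs]
  refine Real.sqrt_le_sqrt (le_trans ?_ hA)
  rw [standardizedIndicator, div_pow, Real.sq_sqrt hD.le]
  refine div_le_div_of_nonneg_right ?_ hD.le
  split_ifs <;> nlinarith [hα.1, hα.2]

theorem integrable_indicator_Ico (p q : ℝ) (τ : Measure ℝ) [IsFiniteMeasure τ] :
    Integrable (fun t : ℝ => if p ≤ t ∧ t < q then (1 : ℝ) else 0) τ :=
  Integrable.of_bound (measurable_indicator_Ico p q).aestronglyMeasurable 1
    (Filter.Eventually.of_forall fun t => by split_ifs <;> simp)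

theorem integral_standardizedIndicator {p q α : ℝ} {τ : Measure ℝ} [IsProbabilityMeasure τ]
    (hτ : ∫ t, (if p ≤ t ∧ t < q then (1 : ℝ) else 0) ∂τ = α) :
    ∫ t, standardizedIndicator p q α t ∂τ = 0 := by
  simp only [standardizedIndicator]
  rw [integral_div, integral_sub (integrable_indicator_Ico p q τ) (integrable_const _), hτ]
  simp

theorem integral_standardizedIndicator_mul_self {p q α : ℝ} {τ : Measure ℝ}
    [IsProbabilityMeasure τ] (hα : 0 < α ∧ α < 1)
    (hτ : ∫ t, (if p ≤ t ∧ t < q then (1 : ℝ) else 0) ∂τ = α) :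
    ∫ t, standardizedIndicator p q α t * standardizedIndicator p q α t ∂τ = 1 := by
  have hD : 0 < α * (1 - α) := mul_pos hα.1 (sub_pos.2 hα.2)
  have h : ∀ t, standardizedIndicator p q α t * standardizedIndicator p q α t =
      ((1 - 2 * α) * (if p ≤ t ∧ t < q then (1 : ℝ) else 0) + α ^ 2) / (α * (1 - α)) := by
    intro t
    rw [standardizedIndicator, ← sq, div_pow, Real.sq_sqrt hD.le]
    congr 1
    split_ifs <;> ring
  simp only [h]
  rw [integral_div, integral_add ((integrable_indicator_Ico p q τ).const_mul _)
    (integrable_const _), integral_const_mul, hτ, div_eq_one_iff_eq hD.ne']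
  simp
  ring

theorem integral_standardizedIndicator_mul {p q α : ℝ} {τ : Measure ℝ} {g : ℝ → ℝ}
    (hg : Integrable g τ)
    (hg0 : ∫ t, g t ∂τ = 0) {θ : ℝ}
    (hzg : ∫ t, (if p ≤ t ∧ t < q then (1 : ℝ) else 0) * g t ∂τ = -θ) :
    ∫ t, standardizedIndicator p q α t * g t ∂τ = -θ / √(α * (1 - α)) := by
  have h : ∀ t, standardizedIndicator p q α t * g t =
      ((if p ≤ t ∧ t < q then (1 : ℝ) else 0) * g t - α * g t) / √(α * (1 - α)) := by
    intro t
    rw [standardizedIndicator]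
    ring
  simp only [h]
  rw [integral_div, integral_sub _ (hg.const_mul α), integral_const_mul, hg0, hzg]
  · simp
  · refine (hg.bdd_mul (c := 1) (measurable_indicator_Ico p q).aestronglyMeasurable
      (Filter.Eventually.of_forall fun t => ?_))
    split_ifs <;> simp

theorem hasSubgaussianMGF_weighted_bounded {E : Type*} [MeasurableSpace E] {Q : Measure E}
    [IsProbabilityMeasure Q] {w F : E → ℝ} (hw : Measurable w) (hw0 : ∀ x, 0 ≤ w x)
    (hw1 : ∀ x, w x ≤ 1) (hF : Measurable F) {R : NNReal} (hFR : ∀ x, |F x| ≤ R) :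
    HasSubgaussianMGF (fun x => w x * F x - ∫ x, w x * F x ∂Q) (R ^ 2) Q := by
  have h := hasSubgaussianMGF_of_mem_Icc (X := fun x => w x * F x) (μ := Q) (a := -(R : ℝ)) (b := R)
    (hw.mul hF).aemeasurable (Filter.Eventually.of_forall fun x => abs_le.1 ?_)
  · convert h using 2
    ext
    push_cast
    rw [sub_neg_eq_add, Real.norm_of_nonneg (by positivity)]
    ring
  · rw [abs_mul, abs_of_nonneg (hw0 x)]
    exact (mul_le_of_le_one_left (abs_nonneg _) (hw1 x)).trans (hFR x)

/-- A weighted residual `w * φ * (g + r * u)` with bounded scores `φ`, `u` and sub-Gaussian `g`. -/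
theorem hasSubgaussianMGF_weighted_residual {E : Type*} [MeasurableSpace E] {Q T : Measure E}
    [IsProbabilityMeasure Q] [IsProbabilityMeasure T]
    {w : E → ℝ} {C : ℝ} (hw : Measurable w) (hw0 : ∀ x, 0 ≤ w x) (hw1 : ∀ x, w x ≤ 1) (hC : 0 ≤ C)
    (hC1 : C ≤ 1)
    (hQT : Q.withDensity (fun x => ENNReal.ofReal (w x)) = ENNReal.ofReal C • T)
    {φ u g : E → ℝ} (hφ : Measurable φ) (hu : Measurable u) (hg : Measurable g)
    {R : NNReal} (hR : 1 ≤ R) (hφR : ∀ x, |φ x| ≤ R) (huR : ∀ x, |u x| ≤ R) {κ : NNReal}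
    (hgK : HasSubgaussianMGF g (κ ^ 2) T) {r : ℝ} (hr : |r| ≤ κ * R)
    (hmean : ∫ x, φ x * (g x + r * u x) ∂T = 0) :
    HasSubgaussianMGF (fun x => w x * (φ x * (g x + r * u x))) (9 * R ^ 6 * κ ^ 2) Q := by
  have hG := hasSubgaussianMGF_weighted_sub_integral hw hw0 hw1 hC hC1 hQT (hφ.mul hg) hgK
    (B := R) fun x => by
      rw [Pi.mul_apply, abs_mul]
      exact mul_le_mul_of_nonneg_right (hφR x) (abs_nonneg _)
  have hU := (hasSubgaussianMGF_weighted_bounded (Q := Q) hw hw0 hw1 (hφ.mul hu) (R := R * R)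
    fun x => by
      rw [Pi.mul_apply, abs_mul, NNReal.coe_mul]
      exact mul_le_mul (hφR x) (huR x) (abs_nonneg _) R.2).const_mul r
  have hφgT : Integrable (fun x => φ x * g x) T :=
    hgK.integrable.bdd_mul hφ.aestronglyMeasurable (Filter.Eventually.of_forall hφR)
  have hφuT : Integrable (fun x => φ x * u x) T :=
    (Integrable.of_bound hu.aestronglyMeasurable R (Filter.Eventually.of_forall huR)).bdd_mul
      hφ.aestronglyMeasurable (Filter.Eventually.of_forall hφR)
  have hzero : ∫ x, w x * (φ x * g x) ∂Q + r * ∫ x, w x * (φ x * u x) ∂Q = 0 := by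
    rw [integral_mul_of_withDensity_eq hw hw0 hC hQT, integral_mul_of_withDensity_eq hw hw0 hC hQT]
    have : ∫ x, φ x * (g x + r * u x) ∂T = ∫ x, φ x * g x ∂T + r * ∫ x, φ x * u x ∂T := by
      rw [← integral_const_mul, ← integral_add hφgT (hφuT.const_mul r)]
      congr 1
      ext x
      ring
    rw [hmean] at this
    linear_combination (-C) * this
  refine HasSubgaussianMGF.mono ((hG.add hU).congr (Filter.Eventually.of_forall fun x => ?_)) ?_
  · simp only [Pi.mul_apply]
    linear_combination (-1) * hzero
  · have h1 : NNReal.sqrt (4 * R ^ 2 * κ ^ 2) = 2 * R * κ := by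
      rw [NNReal.sqrt_eq_iff_eq_sq]
      ring
    have h2 : ∀ c : NNReal, (c : ℝ) = r ^ 2 → NNReal.sqrt (c * (R * R) ^ 2) ≤ κ * R ^ 3 := by
      intro c hc
      rw [NNReal.sqrt_le_iff_le_sq, ← NNReal.coe_le_coe]
      have hr2 : r ^ 2 ≤ (κ * R) ^ 2 := by
        rw [← sq_abs r]
        gcongr
      push_cast
      rw [hc]
      calc r ^ 2 * ((R : ℝ) * R) ^ 2 ≤ ((κ : ℝ) * R) ^ 2 * (R * R) ^ 2 := by gcongr
        _ = ((κ : ℝ) * R ^ 3) ^ 2 := by ring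
    have h3 : R ≤ R ^ 3 := le_self_pow₀ hR (by norm_num)
    calc _ ≤ (2 * R ^ 3 * κ + κ * R ^ 3) ^ 2 := by
          rw [h1]
          gcongr
          exact h2 _ rfl
      _ = 9 * R ^ 6 * κ ^ 2 := by ring

theorem integral_pi_cons_one_mul_eval {d : ℕ} {τ : Fin d → Measure ℝ}
    [∀ j, IsProbabilityMeasure (τ j)] {u : Fin d → ℝ → ℝ} (hu : ∀ j, Measurable (u j))
    (hu0 : ∀ j, ∫ t, u j t ∂τ j = 0) {h : Fin d → ℝ → ℝ} (hh : ∀ j, Measurable (h j))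
    (hh0 : ∀ j, ∫ t, h j t ∂τ j = 0) {c : ℝ} (huh : ∀ j, ∫ t, u j t * h j t ∂τ j = c)
    (k : Fin (d + 1)) (j : Fin d) :
    ∫ x : Fin d → ℝ, (Fin.cons 1 fun j => u j (x j) : Fin (d + 1) → ℝ) k * h j (x j)
      ∂Measure.pi τ = if k = j.succ then c else 0 := by
  refine Fin.cases ?_ (fun i => ?_) k
  · simp only [Fin.cons_zero, one_mul, if_neg (Fin.succ_ne_zero j).symm]
    rw [integral_comp_eval (hh j).aestronglyMeasurable, hh0]
  · simp only [Fin.cons_succ, Fin.succ_inj]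
    split_ifs with hij
    · subst hij
      rw [← huh i]
      exact integral_comp_eval (μ := τ) (f := fun t => u i t * h i t)
        ((hu i).mul (hh i)).aestronglyMeasurable
    · rw [integral_pi_eval_mul_eval (hu i) (hh j) hij, hu0, zero_mul]

theorem integral_pi_cons_one_mul {d : ℕ} {τ : Fin d → Measure ℝ}
    [∀ j, IsProbabilityMeasure (τ j)] {u : Fin d → ℝ → ℝ} (hu : ∀ j, Measurable (u j))
    (hu0 : ∀ j, ∫ t, u j t ∂τ j = 0) (huu : ∀ j, ∫ t, u j t * u j t ∂τ j = 1)
    (k l : Fin (d + 1)) :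
    ∫ x : Fin d → ℝ, (Fin.cons 1 fun j => u j (x j) : Fin (d + 1) → ℝ) k *
      (Fin.cons 1 fun j => u j (x j) : Fin (d + 1) → ℝ) l ∂Measure.pi τ =
        if k = l then 1 else 0 := by
  refine Fin.cases ?_ (fun j => ?_) l
  · refine Fin.cases (by simp) (fun i => ?_) k
    simp only [Fin.cons_zero, Fin.cons_succ, mul_one, if_neg (Fin.succ_ne_zero i)]
    rw [integral_comp_eval (hu i).aestronglyMeasurable, hu0]
  · exact integral_pi_cons_one_mul_eval hu hu0 hu hu0 huu k j

theorem pi_measureReal_exists_abs_mean_gt_le {E ι : Type*} [MeasurableSpace E] [Fintype ι]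
    {Q : Measure E} [IsProbabilityMeasure Q] {Y : ι → E → ℝ} (hYm : ∀ i, Measurable (Y i))
    {c : NNReal} (hY : ∀ i, HasSubgaussianMGF (Y i) c Q) {n : ℕ} (hn : 1 ≤ n) {s : ℝ}
    (hs : 0 ≤ s) {δ : ℝ} (hδ : exp (-(n * s ^ 2) / (2 * c)) ≤ δ) :
    (Measure.pi fun _ : Fin n => Q).real {ω | ∃ i, s < |(n : ℝ)⁻¹ * ∑ m, Y i (ω m)|} ≤
      Fintype.card ι * (2 * δ) := by
  have hsub : {ω : Fin n → E | ∃ i, s < |(n : ℝ)⁻¹ * ∑ m, Y i (ω m)|} ⊆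
      ⋃ i, {ω | s ≤ |(n : ℝ)⁻¹ * ∑ m, Y i (ω m)|} := by
    rintro ω ⟨i, hi⟩
    exact Set.mem_iUnion.2 ⟨i, hi.le⟩
  calc _ ≤ ∑ i, (Measure.pi fun _ : Fin n => Q).real {ω | s ≤ |(n : ℝ)⁻¹ * ∑ m, Y i (ω m)|} :=
        (measureReal_mono hsub).trans (measureReal_iUnion_fintype_le _)
    _ ≤ ∑ _i : ι, 2 * δ := Finset.sum_le_sum fun i _ =>
        (pi_measureReal_abs_mean_ge_le (hYm i) (hY i) hn hs).trans (by gcongr)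
    _ = Fintype.card ι * (2 * δ) := by simp

theorem log_le_of_gram_sample_size {d n A C L : ℝ} (hd : 1 ≤ d) (hA : 0 < A) (hC : 0 < C)
    (hL : 0 ≤ L) (hn : 18 * d ^ 2 * A ^ 2 / C ^ 2 * L ≤ n) :
    L ≤ n * (2 * C / (3 * (d + 1))) ^ 2 / (2 * A ^ 2) := by
  rw [div_mul_eq_mul_div, div_le_iff₀ (by positivity)] at hn
  rw [div_pow, mul_div_assoc', div_div, le_div_iff₀ (by positivity)]
  have hd2 : (d + 1) ^ 2 ≤ 4 * d ^ 2 := by nlinarith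
  calc L * ((3 * (d + 1)) ^ 2 * (2 * A ^ 2)) = 18 * (L * A ^ 2) * (d + 1) ^ 2 := by ring
    _ ≤ 18 * (L * A ^ 2) * (4 * d ^ 2) := by gcongr
    _ = 4 * (18 * d ^ 2 * A ^ 2 * L) := by ring
    _ ≤ 4 * (n * C ^ 2) := by gcongr
    _ = n * (2 * C) ^ 2 := by ring

theorem log_le_of_residual_sample_size {d n A C L ε F κ N : ℝ} (hd : 1 ≤ d) (hA : 0 < A)
    (hC : 0 < C) (hL : 0 ≤ L) (hε : 0 < ε) (hκ : 0 < κ) (hN : 0 < N)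
    (hn : 648 * d ^ 5 * A ^ 4 * (3 * F ^ 2 + κ ^ 2 * N) / (C ^ 2 * ε ^ 2) * L ≤ n) :
    L ≤ n * (ε ^ 2 * C ^ 2 / (36 * (d ^ 3 * A * N))) / (2 * (9 * A ^ 3 * κ ^ 2)) := by
  rw [div_mul_eq_mul_div, div_le_iff₀ (by positivity)] at hn
  rw [mul_div_assoc', div_div, le_div_iff₀ (by positivity)]
  calc L * (36 * (d ^ 3 * A * N) * (2 * (9 * A ^ 3 * κ ^ 2)))
      = 648 * d ^ 3 * A ^ 4 * (κ ^ 2 * N) * L := by ring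
    _ ≤ 648 * d ^ 5 * A ^ 4 * (3 * F ^ 2 + κ ^ 2 * N) * L := by
        gcongr
        · norm_num
        · nlinarith [sq_nonneg F]
    _ ≤ n * (C ^ 2 * ε ^ 2) := hn
    _ = n * (ε ^ 2 * C ^ 2) := by ring

theorem one_le_one_div_mul_one_sub {α : ℝ} (hα : 0 < α ∧ α < 1) : 1 ≤ 1 / (α * (1 - α)) := by
  rw [le_div_iff₀ (mul_pos hα.1 (sub_pos.2 hα.2))]
  nlinarith [hα.1, hα.2]

theorem union_bound_gram {d η : ℝ} (hd : 1 ≤ d) (hη : 0 < η) :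
    (d + 1) * (d + 1) * (2 * (η / (24 * d ^ 2))) ≤ η / 3 := by
  have h : (d + 1) * (d + 1) ≤ 4 * d ^ 2 := by nlinarith
  calc _ ≤ 4 * d ^ 2 * (2 * (η / (24 * d ^ 2))) := by gcongr
    _ = η / 3 := by field_simp; norm_num

theorem union_bound_residual {d η : ℝ} (hd : 1 ≤ d) (hη : 0 < η) :
    (d + 1) * d * (2 * (η / (24 * d ^ 2))) ≤ η / 6 := by
  have h : (d + 1) * d ≤ 2 * d ^ 2 := by nlinarith
  calc _ ≤ 2 * d ^ 2 * (2 * (η / (24 * d ^ 2))) := by gcongr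
    _ = η / 6 := by field_simp; norm_num

theorem linear_sub_fit_eq_sum_residual {d : ℕ} {α : Fin d → ℝ} (hα : ∀ j, 0 < α j ∧ α j < 1)
    (a x m θ z : Fin d → ℝ) (b : ℝ) :
    (∑ j, a j * x j) + b - (1 * ((∑ j, a j * m j) + b + ∑ j, a j * θ j / (1 - α j)) +
      ∑ j, z j * (-(a j * θ j) / (α j * (1 - α j)))) =
    ∑ j, a j * (x j - m j +
      θ j / √(α j * (1 - α j)) * ((z j - α j) / √(α j * (1 - α j)))) := by
  have hterm : ∀ j, a j * (x j - m j +
      θ j / √(α j * (1 - α j)) * ((z j - α j) / √(α j * (1 - α j)))) =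
      a j * x j - a j * m j - a j * θ j / (1 - α j) -
        z j * (-(a j * θ j) / (α j * (1 - α j))) := by
    intro j
    have hα0 := (hα j).1.ne'
    have hα1 := (sub_pos.2 (hα j).2).ne'
    rw [div_mul_div_comm, Real.mul_self_sqrt (mul_pos (hα j).1 (sub_pos.2 (hα j).2)).le]
    field_simp
    ring
  simp only [hterm, Finset.sum_sub_distrib]
  ring

theorem abs_gaussian_increment_le {s : ℝ} (hs : 0 < s) (y y' : ℝ) :
    |s / √(2 * π) * (exp (-y ^ 2 / (2 * s ^ 2)) - exp (-y' ^ 2 / (2 * s ^ 2)))| ≤ s := by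
  have hpi : 1 ≤ √(2 * π) := Real.one_le_sqrt.2 (by linarith [Real.two_le_pi])
  have hexp : ∀ y : ℝ, 0 < exp (-y ^ 2 / (2 * s ^ 2)) ∧ exp (-y ^ 2 / (2 * s ^ 2)) ≤ 1 :=
    fun y => ⟨exp_pos _, Real.exp_le_one_iff.2 <| div_nonpos_of_nonpos_of_nonneg
      (neg_nonpos.2 (sq_nonneg y)) (by positivity)⟩
  rw [abs_mul, abs_of_nonneg (by positivity)]
  refine (mul_le_of_le_one_right (by positivity) ?_).trans (div_le_self hs.le hpi)
  rw [abs_le]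
  constructor <;> linarith [hexp y, hexp y']

theorem integrable_standardizedIndicator (p q α : ℝ) (τ : Measure ℝ) [IsFiniteMeasure τ] :
    Integrable (standardizedIndicator p q α) τ :=
  ((integrable_indicator_Ico p q τ).sub (integrable_const α)).div_const _

theorem integrable_sub_mean_gaussianReal (m : ℝ) (v : NNReal) :
    Integrable (fun t => t - m) (gaussianReal m v) :=
  ((memLp_id_gaussianReal 1).integrable le_rfl).sub (integrable_const m)

theorem integral_sub_mean_gaussianReal (m : ℝ) (v : NNReal) :
    ∫ t, (t - m) ∂gaussianReal m v = 0 := by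
  have hid : Integrable (fun t : ℝ => t) (gaussianReal m v) :=
    (memLp_id_gaussianReal 1).integrable le_rfl
  rw [integral_sub hid (integrable_const m)]
  simp

theorem integral_residual_gaussianReal {p q α θ m : ℝ} {v : NNReal}
    (hz : ∫ t, (if p ≤ t ∧ t < q then (1 : ℝ) else 0) ∂gaussianReal m v = α) :
    ∫ t, (t - m + θ / √(α * (1 - α)) * standardizedIndicator p q α t) ∂gaussianReal m v = 0 := by
  rw [integral_add (integrable_sub_mean_gaussianReal m v)
    ((integrable_standardizedIndicator p q α _).const_mul _), integral_const_mul,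
    integral_standardizedIndicator hz, integral_sub_mean_gaussianReal, mul_zero, add_zero]

theorem integral_standardizedIndicator_mul_residual_gaussianReal {p q α θ m : ℝ} {v : NNReal}
    (hα : 0 < α ∧ α < 1)
    (hz : ∫ t, (if p ≤ t ∧ t < q then (1 : ℝ) else 0) ∂gaussianReal m v = α)
    (hzg : ∫ t, (if p ≤ t ∧ t < q then (1 : ℝ) else 0) * (t - m) ∂gaussianReal m v = -θ) :
    ∫ t, standardizedIndicator p q α t *
      (t - m + θ / √(α * (1 - α)) * standardizedIndicator p q α t) ∂gaussianReal m v = 0 := by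
  have hg := integrable_sub_mean_gaussianReal m v
  have hbdd : ∀ t, ‖standardizedIndicator p q α t‖ ≤ √(1 / (α * (1 - α))) :=
    abs_standardizedIndicator_le hα le_rfl
  have hmeas := (measurable_standardizedIndicator p q α).aestronglyMeasurable
    (μ := gaussianReal m v)
  have hexp : ∀ t, standardizedIndicator p q α t *
      (t - m + θ / √(α * (1 - α)) * standardizedIndicator p q α t) =
      standardizedIndicator p q α t * (t - m) + θ / √(α * (1 - α)) *
        (standardizedIndicator p q α t * standardizedIndicator p q α t) := fun t => by ring
  simp only [hexp]
  rw [integral_add (hg.bdd_mul hmeas (Filter.Eventually.of_forall hbdd))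
      (((integrable_standardizedIndicator p q α _).bdd_mul hmeas
        (Filter.Eventually.of_forall hbdd)).const_mul _),
    integral_const_mul, integral_standardizedIndicator_mul_self hα hz,
    integral_standardizedIndicator_mul hg (integral_sub_mean_gaussianReal m v) hzg]
  ring

/-- Concentration of the TabularLIME coefficients `β̂` around `β = Σ⁻¹Γ`
(Theorem 3.1 / Theorem A.1 of the paper). -/
theorem concentration_beta_hat (d n : ℕ) (hd : 1 ≤ d) (hn1 : 1 ≤ n)
    (ξ μ : Fin d → ℝ) (σ ν : ℝ) (hσ : 0 < σ) (hν : 0 < ν)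
    (a : Fin d → ℝ) (ha : a ≠ 0) (b : ℝ)
    (f : (Fin d → ℝ) → ℝ) (hf : ∀ x, f x = (∑ j, a j * x j) + b)
    (qm qp : Fin d → ℝ) (hq : ∀ j, qm j < qp j) (hqξ : ∀ j, qm j ≤ ξ j ∧ ξ j < qp j)
    (μt : Fin d → ℝ) (hμt : ∀ j, μt j = (ν ^ 2 * μ j + σ ^ 2 * ξ j) / (ν ^ 2 + σ ^ 2))
    (σt : ℝ) (hσt : σt = ν * σ / Real.sqrt (ν ^ 2 + σ ^ 2))
    (Cd : ℝ)
    (hCd : Cd = (ν ^ 2 / (ν ^ 2 + σ ^ 2)) ^ ((d : ℝ) / 2) *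
        Real.exp (-(∑ j, (ξ j - μ j) ^ 2) / (2 * (ν ^ 2 + σ ^ 2))))
    (α : Fin d → ℝ)
    (hα : ∀ j, α j = ∫ s in (qm j)..(qp j),
        Real.exp (-(s - μt j) ^ 2 / (2 * σt ^ 2)) / (σt * Real.sqrt (2 * Real.pi)))
    (hα01 : ∀ j, 0 < α j ∧ α j < 1)
    (θ : Fin d → ℝ)
    (hθ : ∀ j, θ j = σt / Real.sqrt (2 * Real.pi) *
        (Real.exp (-(qp j - μt j) ^ 2 / (2 * σt ^ 2)) -
          Real.exp (-(qm j - μt j) ^ 2 / (2 * σt ^ 2))))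
    (A : ℝ)
    (hA : IsGreatest (Set.range fun j : Fin d => 1 / (α j * (1 - α j))) A)
    (ζ : (Fin d → ℝ) → Fin (d + 1) → ℝ)
    (hζ0 : ∀ x, ζ x 0 = 1)
    (hζs : ∀ x (j : Fin d), ζ x j.succ = if qm j ≤ x j ∧ x j < qp j then (1 : ℝ) else 0)
    (Shat : (Fin n → Fin d → ℝ) → Matrix (Fin (d + 1)) (Fin (d + 1)) ℝ)
    (hShat : ∀ ω, Shat ω = (n : ℝ)⁻¹ •
        ∑ i, Real.exp (-(∑ j, (ω i j - ξ j) ^ 2) / (2 * ν ^ 2)) •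
          Matrix.vecMulVec (ζ (ω i)) (ζ (ω i)))
    (Γhat : (Fin n → Fin d → ℝ) → Fin (d + 1) → ℝ)
    (hΓhat : ∀ ω, Γhat ω = (n : ℝ)⁻¹ •
        ∑ i, (Real.exp (-(∑ j, (ω i j - ξ j) ^ 2) / (2 * ν ^ 2)) * f (ω i)) • ζ (ω i))
    (S : Matrix (Fin (d + 1)) (Fin (d + 1)) ℝ)
    (hS00 : S 0 0 = Cd)
    (hS0j : ∀ j : Fin d, S 0 j.succ = Cd * α j)
    (hSj0 : ∀ j : Fin d, S j.succ 0 = Cd * α j)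
    (hSjj : ∀ j : Fin d, S j.succ j.succ = Cd * α j)
    (hSjk : ∀ j k : Fin d, j ≠ k → S j.succ k.succ = Cd * α j * α k)
    (Γ : Fin (d + 1) → ℝ)
    (hΓ0 : Γ 0 = Cd * f μt)
    (hΓj : ∀ j : Fin d, Γ j.succ = Cd * (α j * f μt - a j * θ j))
    (P : Measure (Fin n → Fin d → ℝ))
    (hP : P = Measure.pi fun _ =>
        Measure.pi fun j => gaussianReal (μ j) ⟨σ ^ 2, sq_nonneg σ⟩)
    (η : ℝ) (hη : η ∈ Set.Ioo (0 : ℝ) 1) (ε : ℝ) (hε : 0 < ε)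
    (hn : max (max
        (288 * (∑ j, a j ^ 2) * σ ^ 2 * d ^ 2 * A ^ 2 / (ε ^ 2 * Cd ^ 2) *
          Real.log (12 * d / η))
        (18 * d ^ 2 * A ^ 2 / Cd ^ 2 * Real.log (24 * d ^ 2 / η)))
        (648 * d ^ 5 * A ^ 4 * (3 * f μt ^ 2 + σt ^ 2 * ∑ j, a j ^ 2) /
          (Cd ^ 2 * ε ^ 2) * Real.log (24 * d ^ 2 / η))
      ≤ (n : ℝ)) :
    1 - ENNReal.ofReal η ≤
      P {ω | IsUnit (Shat ω) ∧
        Real.sqrt (∑ k, ((Shat ω)⁻¹.mulVec (Γhat ω) k - S⁻¹.mulVec Γ k) ^ 2) ≤ ε} := by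
  obtain ⟨hη0, hη1⟩ := hη
  have hd1 : (1 : ℝ) ≤ d := by exact_mod_cast hd
  have hn0 : (0 : ℝ) < n := by exact_mod_cast hn1
  have hσt0 : 0 < σt := by rw [hσt]; positivity
  have hC0 : 0 < Cd := by rw [hCd]; positivity
  have hAle : ∀ j, 1 / (α j * (1 - α j)) ≤ A := fun j => hA.2 ⟨j, rfl⟩
  have hA1 : 1 ≤ A := (one_le_one_div_mul_one_sub (hα01 ⟨0, hd⟩)).trans (hAle _)
  have hsum : 0 < ∑ j, a j ^ 2 := by
    obtain ⟨j, hj⟩ := Function.ne_iff.1 ha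
    exact Finset.sum_pos' (fun _ _ => sq_nonneg _) ⟨j, Finset.mem_univ j, by
      simpa using sq_pos_of_ne_zero hj⟩
  obtain ⟨v, hv⟩ : ∃ v : NNReal, v = ⟨σ ^ 2, sq_nonneg σ⟩ := ⟨_, rfl⟩
  rw [← hv] at hP
  have hv' : (v : ℝ) = σ ^ 2 := by rw [hv]; rfl
  obtain ⟨κ, hκ⟩ : ∃ κ : NNReal, (κ : ℝ) = σt := ⟨⟨σt, hσt0.le⟩, rfl⟩
  obtain ⟨R, hR⟩ : ∃ R : NNReal, (R : ℝ) = √A := ⟨⟨√A, sqrt_nonneg A⟩, rfl⟩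
  have hvt : ((κ ^ 2 : NNReal) : ℝ) = σt ^ 2 := by rw [NNReal.coe_pow, hκ]
  have hR1 : 1 ≤ R := by
    rw [← NNReal.coe_le_coe, hR]
    exact Real.one_le_sqrt.2 hA1
  have hR2 : (R : ℝ) ^ 2 = A := by rw [hR, Real.sq_sqrt (by positivity)]
  set w : (Fin d → ℝ) → ℝ := fun x => exp (-(∑ j, (x j - ξ j) ^ 2) / (2 * ν ^ 2)) with hw_def
  have hw : Measurable w := by fun_prop
  have hw0 : ∀ x, 0 ≤ w x := fun x => (exp_pos _).le
  have hw1 : ∀ x, w x ≤ 1 := fun x => Real.exp_le_one_iff.2 <|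
    div_nonpos_of_nonpos_of_nonneg
      (neg_nonpos.2 (Finset.sum_nonneg fun _ _ => sq_nonneg _)) (by positivity)
  set Q := Measure.pi fun j => gaussianReal (μ j) v with hQ
  set T := Measure.pi fun j => gaussianReal (μt j) (κ ^ 2) with hT
  have hQT : Q.withDensity (fun x => ENNReal.ofReal (w x)) = ENNReal.ofReal Cd • T := by
    rw [hCd]
    exact pi_gaussianReal_withDensity_exp hσ hν hσt hv' hvt hμt
  have hC1 : Cd ≤ 1 := by
    have h := integral_mul_of_withDensity_eq hw hw0 hC0.le hQT fun _ => 1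
    simp only [mul_one, integral_const, probReal_univ, smul_eq_mul] at h
    rw [← h]
    calc ∫ x, w x ∂Q ≤ ∫ _x, 1 ∂Q := integral_mono
          (Integrable.of_bound hw.aestronglyMeasurable 1 (Filter.Eventually.of_forall fun x => by
            rw [Real.norm_of_nonneg (hw0 x)]
            exact hw1 x)) (integrable_const _) hw1
      _ = 1 := by simp
  set u : Fin d → ℝ → ℝ := fun j => standardizedIndicator (qm j) (qp j) (α j) with hu_def
  have hu : ∀ j, Measurable (u j) := fun j => measurable_standardizedIndicator _ _ _
  set r : Fin d → ℝ := fun j => θ j / √(α j * (1 - α j)) with hr_def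
  have hz : ∀ j, ∫ t, (if qm j ≤ t ∧ t < qp j then (1 : ℝ) else 0)
      ∂gaussianReal (μt j) (κ ^ 2) = α j := by
    intro j
    have h := integral_indicator_mul_gaussianReal (m := μt j) hσt0 hvt (hq j).le fun _ => 1
    simp only [mul_one] at h
    rw [h, hα]
  have hzg : ∀ j, ∫ t, (if qm j ≤ t ∧ t < qp j then (1 : ℝ) else 0) * (t - μt j)
      ∂gaussianReal (μt j) (κ ^ 2) = -θ j := fun j => by
    rw [integral_indicator_mul_sub_gaussianReal hσt0 hvt (hq j).le, hθ]
  have hu0 : ∀ j, ∫ t, u j t ∂gaussianReal (μt j) (κ ^ 2) = 0 := fun j =>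
    integral_standardizedIndicator (hz j)
  have huu : ∀ j, ∫ t, u j t * u j t ∂gaussianReal (μt j) (κ ^ 2) = 1 := fun j =>
    integral_standardizedIndicator_mul_self (hα01 j) (hz j)
  have huR : ∀ j t, |u j t| ≤ R := fun j t => by
    rw [hR]
    exact abs_standardizedIndicator_le (hα01 j) (hAle j) t
  set h : Fin d → ℝ → ℝ := fun j t => t - μt j + r j * u j t with hh_def
  have hh : ∀ j, Measurable (h j) := fun j => by
    have := hu j
    fun_prop
  have hh0 : ∀ j, ∫ t, h j t ∂gaussianReal (μt j) (κ ^ 2) = 0 := fun j =>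
    integral_residual_gaussianReal (hz j)
  have huh : ∀ j, ∫ t, u j t * h j t ∂gaussianReal (μt j) (κ ^ 2) = 0 := fun j =>
    integral_standardizedIndicator_mul_residual_gaussianReal (hα01 j) (hz j) (hzg j)
  set φ : Fin (d + 1) → (Fin d → ℝ) → ℝ := fun k x =>
    (Fin.cons 1 fun j => u j (x j) : Fin (d + 1) → ℝ) k with hφ_def
  have hφz : ∀ x k, standardize α (ζ x) k = φ k x := by
    intro x k
    refine Fin.cases rfl (fun j => ?_) k
    simp only [standardize, hφ_def, Fin.cons_succ, hζs, hu_def, standardizedIndicator]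
  have hφ : ∀ k, Measurable (φ k) := fun k => by
    refine Fin.cases ?_ (fun j => ?_) k
    · simp only [hφ_def, Fin.cons_zero]
      exact measurable_const
    · simp only [hφ_def, Fin.cons_succ]
      exact (hu j).comp (measurable_pi_apply j)
  have hφR : ∀ k x, |φ k x| ≤ R := fun k x => by
    refine Fin.cases ?_ (fun j => ?_) k
    · simpa [hφ_def] using hR1
    · exact huR j (x j)
  have hr : ∀ j, |r j| ≤ κ * R := by
    intro j
    have hθσ : |θ j| ≤ σt := by
      rw [hθ]
      exact abs_gaussian_increment_le hσt0 _ _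
    rw [hκ, hR, hr_def, abs_div, abs_of_nonneg (sqrt_nonneg _), div_eq_mul_one_div]
    refine mul_le_mul hθσ ?_ (by positivity) hσt0.le
    rw [one_div, ← Real.sqrt_inv, ← one_div]
    exact Real.sqrt_le_sqrt (hAle j)
  have hG_subG : ∀ i : Fin (d + 1) × Fin (d + 1), HasSubgaussianMGF
      (fun x => w x * (φ i.1 x * φ i.2 x) - if i.1 = i.2 then Cd else 0) ((R * R) ^ 2) Q := by
    intro i
    have hmean : ∫ x, w x * (φ i.1 x * φ i.2 x) ∂Q = if i.1 = i.2 then Cd else 0 := by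
      rw [integral_mul_of_withDensity_eq hw hw0 hC0.le hQT,
        integral_pi_cons_one_mul hu hu0 huu i.1 i.2]
      split_ifs <;> simp
    rw [← hmean]
    refine hasSubgaussianMGF_weighted_bounded hw hw0 hw1 ((hφ i.1).mul (hφ i.2)) fun x => ?_
    rw [Pi.mul_apply, abs_mul, NNReal.coe_mul]
    exact mul_le_mul (hφR _ x) (hφR _ x) (abs_nonneg _) R.2
  have hV_subG : ∀ i : Fin (d + 1) × Fin d, HasSubgaussianMGF
      (fun x => w x * (φ i.1 x * h i.2 (x i.2))) (9 * R ^ 6 * κ ^ 2) Q := by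
    intro i
    refine hasSubgaussianMGF_weighted_residual hw hw0 hw1 hC0.le hC1 hQT (hφ i.1)
      ((hu i.2).comp (measurable_pi_apply i.2)) (by fun_prop) hR1 (hφR i.1) (fun x => huR _ _)
      (hasSubgaussianMGF_pi_gaussianReal_eval μt (κ ^ 2) i.2) (hr i.2) ?_
    have := integral_pi_cons_one_mul_eval hu hu0 hh hh0 huh i.1 i.2
    simpa using this
  set δ : ℝ := η / (24 * d ^ 2) with hδ
  have hδ_log : ∀ {y : ℝ}, log (24 * d ^ 2 / η) ≤ y → exp (-y) ≤ δ := by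
    intro y hy
    calc exp (-y) ≤ exp (-log (24 * d ^ 2 / η)) := exp_le_exp.2 (neg_le_neg hy)
      _ = δ := by rw [Real.exp_neg, exp_log (by positivity), inv_div]
  have hlog : 0 ≤ log (24 * d ^ 2 / η) := Real.log_nonneg <| by
    rw [le_div_iff₀ hη0, one_mul]
    linarith [one_le_pow₀ hd1 (n := 2)]
  set t : ℝ := 2 * Cd / (3 * (d + 1)) with ht
  set s : ℝ := ε * Cd / (6 * √(d ^ 3 * A * ∑ j, a j ^ 2)) with hs
  have hs2 : s ^ 2 = ε ^ 2 * Cd ^ 2 / (36 * (d ^ 3 * A * ∑ j, a j ^ 2)) := by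
    rw [hs, div_pow, mul_pow, mul_pow, Real.sq_sqrt (by positivity)]
    norm_num
  have hn2 := (le_max_right _ _).trans ((le_max_left _ _).trans hn)
  have hn3 := (le_max_right _ _).trans hn
  have ht_tail : exp (-(n * t ^ 2) / (2 * ((R * R) ^ 2 : NNReal))) ≤ δ := by
    rw [neg_div]
    refine hδ_log ?_
    push_cast
    rw [← sq, hR2]
    exact log_le_of_gram_sample_size hd1 (by positivity) hC0 hlog hn2
  have hs_tail : exp (-(n * s ^ 2) / (2 * (9 * R ^ 6 * κ ^ 2 : NNReal))) ≤ δ := by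
    rw [neg_div]
    refine hδ_log ?_
    push_cast
    rw [show (R : ℝ) ^ 6 = (R ^ 2) ^ 3 by ring, hR2, hκ, hs2]
    exact log_le_of_residual_sample_size hd1 (by positivity) hC0 hlog hε hσt0 hsum hn3
  set bad₁ : Set (Fin n → Fin d → ℝ) := {ω | ∃ i : Fin (d + 1) × Fin (d + 1), t <
    |(n : ℝ)⁻¹ * ∑ m, (w (ω m) * (φ i.1 (ω m) * φ i.2 (ω m)) - if i.1 = i.2 then Cd else 0)|}
    with hbad₁
  set bad₂ : Set (Fin n → Fin d → ℝ) := {ω | ∃ i : Fin (d + 1) × Fin d, s <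
    |(n : ℝ)⁻¹ * ∑ m, w (ω m) * (φ i.1 (ω m) * h i.2 (ω m i.2))|} with hbad₂
  have hPbad₁ : P.real bad₁ ≤ η / 3 := by
    rw [hP]
    refine (pi_measureReal_exists_abs_mean_gt_le (fun i => ?_) hG_subG hn1 (by positivity)
      ht_tail).trans ?_
    · exact (hw.mul ((hφ i.1).mul (hφ i.2))).sub_const _
    · simp only [Fintype.card_prod, Fintype.card_fin, hδ]
      push_cast
      exact union_bound_gram hd1 hη0
  have hPbad₂ : P.real bad₂ ≤ η / 6 := by
    rw [hP]
    refine (pi_measureReal_exists_abs_mean_gt_le (fun i => ?_) hV_subG hn1 (by positivity)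
      hs_tail).trans ?_
    · exact hw.mul ((hφ i.1).mul ((hh i.2).comp (measurable_pi_apply i.2)))
    · simp only [Fintype.card_prod, Fintype.card_fin, hδ]
      push_cast
      exact union_bound_residual hd1 hη0
  have hβ := inv_mulVec_eq_of_bernoulli_covariance hα01 hC0.ne' hS00 hS0j hSj0 hSjj hSjk hΓ0 hΓj
  have hgood : (bad₁ ∪ bad₂)ᶜ ⊆ {ω | IsUnit (Shat ω) ∧
      √(∑ k, ((Shat ω)⁻¹.mulVec (Γhat ω) k - S⁻¹.mulVec Γ k) ^ 2) ≤ ε} := by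
    intro ω hω
    rw [Set.compl_union] at hω
    obtain ⟨hω₁, hω₂⟩ := hω
    simp only [hbad₁, hbad₂, Set.mem_compl_iff, Set.mem_ofPred_eq, not_exists, not_lt,
      Prod.forall] at hω₁ hω₂
    refine weighted_least_squares_error hd hα01 hAle hC0 (fun i => hζ0 (ω i))
      (H := fun i j => h j (ω i j)) (a := a) (fun i => ?_) (hShat ω) (hΓhat ω) (fun k l => ?_)
      (s := s) (fun k j => ?_) hε.le ?_
    · rw [hβ, Fin.sum_univ_succ]
      simp only [Fin.cons_zero, Fin.cons_succ, hζ0, hf]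
      rw [linear_sub_fit_eq_sum_residual hα01]
      simp only [hζs]
      rfl
    · refine le_of_eq_of_le ?_ (hω₁ k l)
      simp only [hφz]
      rw [Finset.sum_sub_distrib, mul_sub]
      simp [hn0.ne', hw_def]
    · simp only [hφz]
      exact hω₂ k j
    · rw [hs2]
      refine le_of_eq ?_
      field_simp
  have hPprob : IsProbabilityMeasure P := by
    rw [hP]
    infer_instance
  have hPbad : P (bad₁ ∪ bad₂) ≤ ENNReal.ofReal η := by
    rw [← ofReal_measureReal]
    refine ENNReal.ofReal_le_ofReal ((measureReal_union_le _ _).trans ?_)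
    linarith
  rw [tsub_le_iff_right]
  calc (1 : ENNReal) = P Set.univ := measure_univ.symm
    _ ≤ P ((bad₁ ∪ bad₂)ᶜ) + P (bad₁ ∪ bad₂) := by
        rw [← Set.compl_union_self (bad₁ ∪ bad₂)]
        exact measure_union_le _ _
    _ ≤ _ := add_le_add (measure_mono hgood) hPbad
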